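/- Let t ∈ ℚ[X] be any polynomial and let m = ℳ(t). Then for every real number x > 4, setting s = √(x² − 4x) (the positive real square root), one has m(x) = ((x + s)/(2s)) · t((x + s)/2) − ((x − s)/(2s)) · t((x − s)/2), where polynomials are evaluated in ℝ via the algebra map ℚ → ℝ. -/

import Mathlib

open Polynomial

/-- The formula for `ℳ(Xⁿ) = ∑_{k=0}^{⌊n/2⌋} (−1)^k · C(n−k, k) · X^{n−k}`. -/
noncomputable def Mform (n : ℕ) : Polynomial ℚ :=
  ∑ k ∈ Finset.range (n / 2 + 1),
    Polynomial.C ((-1 : ℚ) ^ k * (Nat.choose (n - k) k : ℚ)) * Polynomial.X ^ (n - k)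

/-- The terms beyond `k = ⌊n/2⌋` vanish, so the sum may be extended to `k ≤ n`. -/
lemma Mform_eq_sum_range_succ (n : ℕ) :
    Mform n = ∑ k ∈ Finset.range (n + 1),
      Polynomial.C ((-1 : ℚ) ^ k * (Nat.choose (n - k) k : ℚ)) * Polynomial.X ^ (n - k) := by
  unfold Mform
  apply Finset.sum_subset
  · intro k hk
    simp only [Finset.mem_range] at hk ⊢
    omega
  · intro k _ hk
    simp only [Finset.mem_range] at hk
    rw [Nat.choose_eq_zero_of_lt (by omega)]
    simp

lemma Mform_add_two (n : ℕ) : Mform (n + 2) = X * (Mform (n + 1) - Mform n) := by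
  simp only [Mform_eq_sum_range_succ]
  rw [Finset.sum_range_succ' _ (n + 2), Finset.sum_range_succ _ (n + 1),
    Finset.sum_range_succ' _ (n + 1), add_sub_right_comm, ← Finset.sum_sub_distrib, mul_add,
    Finset.mul_sum]
  have h : n + 2 - (n + 1 + 1) = 0 := by omega
  rw [h, Nat.choose_zero_succ]
  simp only [Nat.cast_zero, mul_zero, map_zero, zero_mul, add_zero]
  congr 1
  · refine Finset.sum_congr rfl fun k hk => ?_
    have hk' : k ≤ n := Nat.lt_succ_iff.mp (Finset.mem_range.mp hk)
    have h₁ : n + 2 - (k + 1) = (n - k) + 1 := by omega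
    have h₂ : n + 1 - (k + 1) = n - k := by omega
    rw [h₁, h₂, Nat.choose_succ_succ]
    simp only [Nat.cast_add, map_mul, map_add, map_pow, map_neg, map_one]
    ring
  · simp
    ring

/-- If `u` and `v` have sum and product both equal to `x`, then `ℳ(Xⁿ)` evaluated at `x` is the
complete homogeneous polynomial of degree `n` in `u` and `v`. -/
lemma sub_mul_aeval_Mform {A : Type*} [CommRing A] [Algebra ℚ A] {u v x : A}
    (hadd : u + v = x) (hmul : u * v = x) (n : ℕ) :
    (u - v) * aeval x (Mform n) = u ^ (n + 1) - v ^ (n + 1) := by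
  induction n using Nat.twoStepInduction with
  | zero => simp [Mform]
  | one =>
    simp [Mform]
    rw [← hadd]
    ring
  | more n ih₀ ih₁ =>
    rw [Mform_add_two, map_mul, aeval_X, map_sub]
    linear_combination x * ih₁ - x * ih₀ - (u ^ (n + 2) - v ^ (n + 2)) * hadd
      + (u ^ (n + 1) - v ^ (n + 1)) * hmul

/-- For `m = ℳ(t)`, real `x > 4` and `s = √(x² − 4x)`:
`m(x) = ((x+s)/(2s)) · t((x+s)/2) − ((x−s)/(2s)) · t((x−s)/2)`. -/
theorem M_real_identity (M : Polynomial ℚ →ₗ[ℚ] Polynomial ℚ)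
    (hM : ∀ n : ℕ, M (Polynomial.X ^ n) = Mform n)
    (t : Polynomial ℚ) (x : ℝ) (hx : 4 < x) :
    Polynomial.aeval x (M t) =
      ((x + Real.sqrt (x ^ 2 - 4 * x)) / (2 * Real.sqrt (x ^ 2 - 4 * x))) *
          Polynomial.aeval ((x + Real.sqrt (x ^ 2 - 4 * x)) / 2) t -
        ((x - Real.sqrt (x ^ 2 - 4 * x)) / (2 * Real.sqrt (x ^ 2 - 4 * x))) *
          Polynomial.aeval ((x - Real.sqrt (x ^ 2 - 4 * x)) / 2) t := by
  have hpos : 0 < x ^ 2 - 4 * x := by nlinarith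
  have hs : Real.sqrt (x ^ 2 - 4 * x) ≠ 0 := (Real.sqrt_pos.mpr hpos).ne'
  have hsq := Real.sq_sqrt hpos.le
  generalize Real.sqrt (x ^ 2 - 4 * x) = s at hs hsq ⊢
  induction t using Polynomial.induction_on' with
  | add p q hp hq =>
    simp only [map_add, hp, hq]
    ring
  | monomial n a =>
    have h := sub_mul_aeval_Mform (u := (x + s) / 2) (v := (x - s) / 2) (x := x) (by ring)
      (by linear_combination -hsq / 4) n
    have hdiff : (x + s) / 2 - (x - s) / 2 = s := by ring
    rw [hdiff] at h
    rw [← smul_X_eq_monomial, map_smul, hM]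
    simp only [map_smul, map_pow, aeval_X]
    simp only [Algebra.smul_def]
    apply mul_left_cancel₀ hs
    rw [mul_left_comm, h, pow_succ, pow_succ]
    generalize ((x + s) / 2) ^ n = p
    generalize ((x - s) / 2) ^ n = q
    field_simp
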